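/- If a homomorphism φ : G → H of finitely generated free groups has remnant, then |zφ| ≥ |z| for every z ∈ G; in particular φ is injective. -/

import Mathlib

/-- The number of letters cancelled in the product `u * v` of elements of a free group:
`c(u,v) = (|u| + |v| - |uv|)/2`. -/
def cancel {κ : Type*} [DecidableEq κ] (u v : FreeGroup κ) : ℕ :=
  (FreeGroup.norm u + FreeGroup.norm v - FreeGroup.norm (u * v)) / 2

/-- The basis letter indexed by `(i, ε)`: `of i` if `ε = true`, `(of i)⁻¹` if `ε = false`. -/
def bLetter {ι : Type*} (p : ι × Bool) : FreeGroup ι :=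
  cond p.2 (FreeGroup.of p.1) (FreeGroup.of p.1)⁻¹

/-- `P_χ(x_i)`: maximal cancellation of `x_iχ` with the image of a basis letter `b ≠ x_i⁻¹`
multiplied on the left. -/
def Pc {ι κ : Type*} [Fintype ι] [DecidableEq ι] [DecidableEq κ]
    (χ : FreeGroup ι →* FreeGroup κ) (i : ι) : ℕ :=
  (Finset.univ.erase (i, false)).sup fun p => cancel (χ (bLetter p)) (χ (FreeGroup.of i))

/-- `S_χ(x_i)`: maximal cancellation of `x_iχ` with the image of a basis letter `b ≠ x_i⁻¹`
multiplied on the right. -/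
def Sc {ι κ : Type*} [Fintype ι] [DecidableEq ι] [DecidableEq κ]
    (χ : FreeGroup ι →* FreeGroup κ) (i : ι) : ℕ :=
  (Finset.univ.erase (i, false)).sup fun p => cancel (χ (FreeGroup.of i)) (χ (bLetter p))

/-- `χ` has remnant if for every basis element a nontrivial subword of its image survives
all the cancellations: `P_χ(x_i) + S_χ(x_i) < |x_iχ|`. -/
def HasRemnant {ι κ : Type*} [Fintype ι] [DecidableEq ι] [DecidableEq κ]
    (χ : FreeGroup ι →* FreeGroup κ) : Prop :=
  ∀ i : ι, Pc χ i + Sc χ i < FreeGroup.norm (χ (FreeGroup.of i))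

/-- The remnant length `|Rem_χ(x_i)| = |x_iχ| - P_χ(x_i) - S_χ(x_i)`. -/
def RemLen {ι κ : Type*} [Fintype ι] [DecidableEq ι] [DecidableEq κ]
    (χ : FreeGroup ι →* FreeGroup κ) (i : ι) : ℕ :=
  FreeGroup.norm (χ (FreeGroup.of i)) - Pc χ i - Sc χ i

namespace List

/-- The length of the longest common prefix of two lists. -/
def commonPrefixLength {α : Type*} [DecidableEq α] : List α → List α → ℕ
  | a :: l, b :: m => if a = b then commonPrefixLength l m + 1 else 0
  | _, _ => 0

theorem min_commonPrefixLength_le {α : Type*} [DecidableEq α] (l m r : List α) :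
    min (commonPrefixLength l m) (commonPrefixLength m r) ≤ commonPrefixLength l r := by
  induction l generalizing m r with
  | nil => simp [commonPrefixLength]
  | cons a l ih =>
    cases m with
    | nil => simp [commonPrefixLength]
    | cons b m =>
      cases r with
      | nil => simp [commonPrefixLength]
      | cons c r =>
        have := ih m r
        simp only [commonPrefixLength]
        grind

end List

namespace FreeGroup

variable {κ : Type*} [DecidableEq κ]

theorem IsReduced.norm_mk {L : List (κ × Bool)} (h : IsReduced L) :
    norm (mk L) = L.length := by
  rw [norm, toWord_mk, h.reduce_eq]

theorem IsReduced.invRev {L : List (κ × Bool)} (h : IsReduced L) :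
    IsReduced (FreeGroup.invRev L) := by
  rw [isReduced_iff_reduce_eq, reduce_invRev, h.reduce_eq]

theorem IsReduced.norm_inv_mul_add {L M : List (κ × Bool)} (hL : IsReduced L)
    (hM : IsReduced M) :
    norm ((mk L)⁻¹ * mk M) + 2 * L.commonPrefixLength M = L.length + M.length := by
  induction L generalizing M with
  | nil => simp [List.commonPrefixLength, ← one_eq_mk, hM.norm_mk]
  | cons x L ih =>
    cases M with
    | nil =>
      rw [← one_eq_mk, mul_one, norm_inv_eq, hL.norm_mk]
      simp [List.commonPrefixLength]
    | cons y M =>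
      by_cases hxy : x = y
      · subst hxy
        have hcons : ∀ N : List (κ × Bool), mk (x :: N) = mk [x] * mk N := fun N => by
          rw [mul_mk, List.singleton_append]
        have key : (mk (x :: L))⁻¹ * mk (x :: M) = (mk L)⁻¹ * mk M := by
          rw [hcons L, hcons M]; group
        have := ih (M := M) (List.IsChain.tail hL) (List.IsChain.tail hM)
        simp only [key, List.commonPrefixLength, if_true, List.length_cons]
        omega
      · have hred : IsReduced (FreeGroup.invRev (x :: L) ++ y :: M) := by
          refine List.isChain_append.2 ⟨hL.invRev, hM, ?_⟩
          intro a ha b hb hab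
          simp only [FreeGroup.invRev, List.map_cons, List.reverse_cons,
            List.getLast?_append, List.getLast?_singleton, List.head?_cons,
            Option.some_or, Option.mem_def, Option.some.injEq] at ha hb
          subst ha hb
          rcases x with ⟨i, _ | _⟩ <;> rcases y with ⟨j, _ | _⟩ <;> simp_all
        rw [inv_mk, mul_mk, hred.norm_mk]
        simp [List.commonPrefixLength, hxy, invRev_length]

end FreeGroup

open FreeGroup

section Cancel

variable {κ : Type*} [DecidableEq κ]

theorem norm_mul_add_two_mul_cancel (u v : FreeGroup κ) :
    FreeGroup.norm (u * v) + 2 * cancel u v = FreeGroup.norm u + FreeGroup.norm v := by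
  obtain ⟨n, hn⟩ := (reduce.red (L := u.toWord ++ v.toWord)).length
  rw [← toWord_mul, List.length_append] at hn
  unfold cancel FreeGroup.norm
  omega

theorem cancel_eq_commonPrefixLength (u v : FreeGroup κ) :
    cancel u v = u⁻¹.toWord.commonPrefixLength v.toWord := by
  have h := IsReduced.norm_inv_mul_add (isReduced_toWord (x := u⁻¹)) (isReduced_toWord (x := v))
  have h' := norm_mul_add_two_mul_cancel u v
  have hu : u⁻¹.toWord.length = FreeGroup.norm u := norm_inv_eq
  have hv : v.toWord.length = FreeGroup.norm v := rfl
  rw [mk_toWord, mk_toWord, inv_inv] at h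
  omega

theorem min_cancel_le (u v w : FreeGroup κ) :
    min (cancel u v⁻¹) (cancel v w) ≤ cancel u w := by
  simp only [cancel_eq_commonPrefixLength]
  exact List.min_commonPrefixLength_le _ _ _

theorem cancel_inv_inv (u v : FreeGroup κ) : cancel v⁻¹ u⁻¹ = cancel u v := by
  unfold cancel
  rw [← mul_inv_rev, norm_inv_eq, norm_inv_eq, norm_inv_eq, add_comm]

theorem cancel_mul_inv_add (u v : FreeGroup κ) :
    cancel v (u * v)⁻¹ + cancel u v = FreeGroup.norm v := by
  have h := norm_mul_add_two_mul_cancel u v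
  have h' := norm_mul_add_two_mul_cancel v (u * v)⁻¹
  rw [mul_inv_rev, mul_inv_cancel_left, ← mul_inv_rev, norm_inv_eq, norm_inv_eq] at h'
  omega

/-- If the cancellations on both sides of `v` do not meet, then multiplying `v` by `u` on the
left does not increase the cancellation on its right. -/
theorem cancel_mul_le {u v w : FreeGroup κ} (h : cancel u v + cancel v w < FreeGroup.norm v) :
    cancel (u * v) w ≤ cancel v w := by
  have h₁ := cancel_mul_inv_add u v
  have h₂ := min_cancel_le v (u * v) w
  omega

end Cancel

section Remnant

variable {ι κ : Type*} [DecidableEq κ] (χ : FreeGroup ι →* FreeGroup κ)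

theorem bLetter_not (i : ι) (b : Bool) : bLetter (i, !b) = (bLetter (i, b))⁻¹ := by
  cases b <;> simp [bLetter]

theorem bLetter_eq_mk (p : ι × Bool) : bLetter p = mk [p] := by
  rcases p with ⟨i, _ | _⟩
  · simp [bLetter, FreeGroup.of, inv_mk, invRev]
  · rfl

theorem cancel_map_bLetter_not (p q : ι × Bool) :
    cancel (χ (bLetter (q.1, !q.2))) (χ (bLetter (p.1, !p.2))) =
      cancel (χ (bLetter p)) (χ (bLetter q)) := by
  rw [bLetter_not, bLetter_not, MonoidHom.map_inv, MonoidHom.map_inv, cancel_inv_inv]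

variable [Fintype ι] [DecidableEq ι]

/-- The bound on the cancellation to the left of the image of a basis letter. -/
def leftBound (p : ι × Bool) : ℕ := cond p.2 (Pc χ p.1) (Sc χ p.1)

/-- The bound on the cancellation to the right of the image of a basis letter. -/
def rightBound (p : ι × Bool) : ℕ := cond p.2 (Sc χ p.1) (Pc χ p.1)

theorem cancel_le_Pc {p : ι × Bool} {i : ι} (h : p ≠ (i, false)) :
    cancel (χ (bLetter p)) (χ (bLetter (i, true))) ≤ Pc χ i :=
  Finset.le_sup (f := fun p => cancel (χ (bLetter p)) (χ (FreeGroup.of i)))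
    (Finset.mem_erase.2 ⟨h, Finset.mem_univ p⟩)

theorem cancel_le_Sc {p : ι × Bool} {i : ι} (h : p ≠ (i, false)) :
    cancel (χ (bLetter (i, true))) (χ (bLetter p)) ≤ Sc χ i :=
  Finset.le_sup (f := fun p => cancel (χ (FreeGroup.of i)) (χ (bLetter p)))
    (Finset.mem_erase.2 ⟨h, Finset.mem_univ p⟩)

theorem cancel_le_leftBound {p q : ι × Bool} (h : p.1 = q.1 → p.2 = q.2) :
    cancel (χ (bLetter p)) (χ (bLetter q)) ≤ leftBound χ q := by
  rcases q with ⟨j, _ | _⟩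
  · rw [← cancel_map_bLetter_not]
    exact cancel_le_Sc χ (by grind)
  · exact cancel_le_Pc χ (by grind)

theorem cancel_le_rightBound {p q : ι × Bool} (h : p.1 = q.1 → p.2 = q.2) :
    cancel (χ (bLetter p)) (χ (bLetter q)) ≤ rightBound χ p := by
  rcases p with ⟨i, _ | _⟩
  · rw [← cancel_map_bLetter_not]
    exact cancel_le_Pc χ (by grind)
  · exact cancel_le_Sc χ (by grind)

variable {χ}

theorem HasRemnant.leftBound_add_rightBound_lt (h : HasRemnant χ) (p : ι × Bool) :
    leftBound χ p + rightBound χ p < FreeGroup.norm (χ (bLetter p)) := by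
  rcases p with ⟨i, _ | _⟩
  · have := h i
    simp only [leftBound, rightBound, bLetter, cond_false, MonoidHom.map_inv, norm_inv_eq]
    omega
  · exact h i

theorem HasRemnant.append_singleton (h : HasRemnant χ) (L : List (ι × Bool)) (p : ι × Bool)
    (hL : IsReduced (L ++ [p])) :
    cancel (χ (mk L)) (χ (bLetter p)) ≤ leftBound χ p ∧
      L.length + 1 + rightBound χ p ≤ FreeGroup.norm (χ (mk (L ++ [p]))) := by
  induction L using List.reverseRecOn generalizing p with
  | nil =>
    have hp := h.leftBound_add_rightBound_lt p
    rw [List.nil_append, ← bLetter_eq_mk, ← one_eq_mk, MonoidHom.map_one]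
    refine ⟨by simp [cancel], ?_⟩
    simp only [List.length_nil]
    omega
  | append_singleton L q ih =>
    obtain ⟨hc, hn⟩ := ih q (List.IsChain.left_of_append hL)
    have hqp : q.1 = p.1 → q.2 = p.2 := by
      rw [List.append_assoc] at hL
      exact (isReduced_cons_cons.1 (List.IsChain.right_of_append hL)).1
    have hp := h.leftBound_add_rightBound_lt p
    have hq := h.leftBound_add_rightBound_lt q
    have hl := cancel_le_leftBound χ hqp
    have hr := cancel_le_rightBound χ hqp
    have hle : cancel (χ (mk (L ++ [q]))) (χ (bLetter p)) ≤
        cancel (χ (bLetter q)) (χ (bLetter p)) := by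
      rw [← mul_mk, ← bLetter_eq_mk, MonoidHom.map_mul]
      exact cancel_mul_le (by omega)
    have hmul := norm_mul_add_two_mul_cancel (χ (mk (L ++ [q]))) (χ (bLetter p))
    rw [← MonoidHom.map_mul, bLetter_eq_mk p, mul_mk, ← bLetter_eq_mk p] at hmul
    refine ⟨hle.trans hl, ?_⟩
    simp only [List.length_append, List.length_singleton]
    omega

theorem HasRemnant.norm_le_norm_map (h : HasRemnant χ) (z : FreeGroup ι) :
    FreeGroup.norm z ≤ FreeGroup.norm (χ z) := by
  rcases List.eq_nil_or_concat' z.toWord with hz | ⟨L, p, hz⟩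
  · simp [FreeGroup.norm, hz]
  · have := (h.append_singleton L p (hz ▸ isReduced_toWord)).2
    rw [← hz, mk_toWord] at this
    rw [FreeGroup.norm, hz, List.length_append, List.length_singleton]
    omega

end Remnant

/-- If a homomorphism `φ : G → H` of finitely generated free groups has remnant, then
`|zφ| ≥ |z|` for every `z ∈ G`; in particular `φ` is injective. -/
theorem remnant_injective {n : ℕ} {κ : Type*} [Fintype κ] [DecidableEq κ]
    (φ : FreeGroup (Fin n) →* FreeGroup κ) (hrem : HasRemnant φ) :
    (∀ z : FreeGroup (Fin n), FreeGroup.norm z ≤ FreeGroup.norm (φ z)) ∧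
      Function.Injective ⇑φ := by
  refine ⟨hrem.norm_le_norm_map, (injective_iff_map_eq_one φ).2 fun z hz => ?_⟩
  have := hrem.norm_le_norm_map z
  rwa [hz, FreeGroup.norm_one, Nat.le_zero, FreeGroup.norm_eq_zero] at this
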